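/- (Incentive compatibility of the threshold-1 scoring rule) Let Ψ ⊆ [n] be such that for every i' ∈ Ψ, (1 − Σ_{i∈Ψ∖{i'}} p_i) · (p_{i'}/2) ≥ c_{i'}. Then the threshold scoring rule with recommendation set Ψ and threshold η = 1 is proper, and the mechanism consisting of this scoring rule together with recommendation set Ψ is incentive compatible: exerting effort on exactly Ψ and reporting truthfully maximizes the agent's expected utility over all effort sets. -/

import Mathlib

open Finset

namespace KS

abbrev Sig (n : ℕ) := Fin n → Option Bool
abbrev St (n : ℕ) := Fin n → Bool

/-- Posterior probability of state profile `ω` induced by signal profile `σ`: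
`ω i = b` with probability 1 when `σ i = some b`, uniform when `σ i = none`. -/
noncomputable def postProb {n : ℕ} (σ : Sig n) (ω : St n) : ℝ :=
  ∏ i, (σ i).elim ((1:ℝ)/2) (fun b => if ω i = b then 1 else 0)

/-- Expectation of `f` over states, under the posterior induced by `σ`. -/
noncomputable def postExp {n : ℕ} (σ : Sig n) (f : St n → ℝ) : ℝ :=
  ∑ ω : St n, postProb σ ω * f ω

/-- A scoring rule is proper if truthful reporting of the signal maximizes the
expected score under the induced posterior. -/
def Proper {n : ℕ} (S : Sig n → St n → ℝ) : Prop :=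
  ∀ σ σ' : Sig n, postExp σ (S σ) ≥ postExp σ (S σ')

/-- Probability of receiving signal profile `σ` when exerting effort exactly on `Ψ`
(with state-revelation probabilities `p`, states uniform and independent). -/
noncomputable def sigProb {n : ℕ} (p : Fin n → ℝ) (Ψ : Finset (Fin n)) (σ : Sig n) : ℝ :=
  ∏ i, if i ∈ Ψ then (σ i).elim (1 - p i) (fun _ => p i / 2)
       else (σ i).elim 1 (fun _ => 0)

/-- Expected score `E_{σ∼Ψ}[E_{ω∼σ}[S(σ,ω)]]` for exerting effort on `Ψ` and
truthfully reporting. -/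
noncomputable def expScore {n : ℕ} (p : Fin n → ℝ) (Ψ : Finset (Fin n))
    (S : Sig n → St n → ℝ) : ℝ :=
  ∑ σ : Sig n, sigProb p Ψ σ * postExp σ (S σ)

/-- Incentive compatibility of the mechanism `(S, Ψ)`. -/
def IC {n : ℕ} (p c : Fin n → ℝ) (S : Sig n → St n → ℝ) (Ψ : Finset (Fin n)) : Prop :=
  Proper S ∧ ∀ Ψ' : Finset (Fin n),
    expScore p Ψ S - ∑ i ∈ Ψ, c i ≥ expScore p Ψ' S - ∑ i ∈ Ψ', c i

/-- Truncated separate scoring rule with budget `B`. -/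
def IsTruncSep {n : ℕ} (B : ℝ) (S : Sig n → St n → ℝ) : Prop :=
  ∃ (T : Fin n → Option Bool → Bool → ℝ) (d : ℝ),
    ∀ σ ω, S σ ω = min B (max 0 (-d + ∑ i, T i (σ i) (ω i)))

open Classical in
/-- Threshold scoring rule with recommendation set `Ψ` and threshold `η`. -/
noncomputable def thresholdScore {n : ℕ} (Ψ : Finset (Fin n)) (η : ℕ)
    (σ : Sig n) (ω : St n) : ℝ :=
  if ∃ i ∈ Ψ, σ i ≠ none ∧ σ i ≠ some (ω i) then 0
  else if η ≤ (Ψ.filter fun i => σ i = some (ω i)).card then 1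
  else (1/2 : ℝ) ^ (η - (Ψ.filter fun i => σ i = some (ω i)).card)

def IsThreshold {n : ℕ} (S : Sig n → St n → ℝ) : Prop :=
  ∃ (Ψ : Finset (Fin n)) (η : ℕ), ∀ σ ω, S σ ω = thresholdScore Ψ η σ ω

end KS

namespace KS

lemma postProb_nonneg {n : ℕ} (σ : Sig n) (ω : St n) : 0 ≤ postProb σ ω := by
  refine prod_nonneg fun i _ => ?_
  cases σ i with
  | none => norm_num
  | some b => simp only [Option.elim_some]; split_ifs <;> norm_num

lemma sum_postProb {n : ℕ} (σ : Sig n) : ∑ ω, postProb σ ω = 1 := by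
  unfold postProb
  rw [← Fintype.prod_sum (fun i (b : Bool) =>
    (σ i).elim ((1 : ℝ) / 2) (fun b' => if b = b' then 1 else 0))]
  refine prod_eq_one fun i _ => ?_
  rcases σ i with _ | _ | _ <;> norm_num

/-- A task without an informative signal has a uniform posterior state. -/
lemma postExp_ite_eq_half {n : ℕ} (σ : Sig n) (i : Fin n) (hi : σ i = none) (b : Bool) :
    postExp σ (fun ω => if ω i = b then 1 else 0) = 1 / 2 := by
  unfold postExp postProb
  have h : ∀ ω : St n, (if ω i = b then (1 : ℝ) else 0)
      = ∏ j, if j = i then (if ω j = b then (1 : ℝ) else 0) else 1 := by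
    intro ω
    simp
  simp_rw [h, ← prod_mul_distrib]
  rw [← Fintype.prod_sum (fun j (a : Bool) =>
    (σ j).elim ((1 : ℝ) / 2) (fun b' => if a = b' then 1 else 0) *
      if j = i then (if a = b then (1 : ℝ) else 0) else 1)]
  rw [Fintype.prod_eq_single i]
  · cases b <;> simp [hi]
  · intro j hj
    rcases σ j with _ | _ | _ <;> norm_num [hj]

lemma postExp_const {n : ℕ} (σ : Sig n) (a : ℝ) : postExp σ (fun _ => a) = a := by
  rw [postExp, ← sum_mul, sum_postProb, one_mul]

lemma postExp_mono {n : ℕ} (σ : Sig n) {f g : St n → ℝ} (h : ∀ ω, f ω ≤ g ω) :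
    postExp σ f ≤ postExp σ g :=
  sum_le_sum fun ω _ => mul_le_mul_of_nonneg_left (h ω) (postProb_nonneg σ ω)

/-- States in the support of the posterior agree with every informative signal. -/
lemma eq_of_postProb_ne_zero {n : ℕ} {σ : Sig n} {ω : St n} (h : postProb σ ω ≠ 0) (i : Fin n) :
    σ i = none ∨ σ i = some (ω i) := by
  have := prod_ne_zero_iff.mp h i (mem_univ i)
  rcases hs : σ i with _ | b
  · exact Or.inl rfl
  · right
    rw [hs, Option.elim_some] at this
    by_contra hne
    exact this (if_neg fun hb => hne (by rw [hb]))

lemma thresholdScore_one_le_one {n : ℕ} (Ψ : Finset (Fin n)) (σ : Sig n) (ω : St n) :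
    thresholdScore Ψ 1 σ ω ≤ 1 := by
  unfold thresholdScore
  split_ifs
  · norm_num
  · norm_num
  · exact pow_le_one₀ (by norm_num) (by norm_num)

lemma thresholdScore_one_of_forall_none {n : ℕ} {Ψ : Finset (Fin n)} {σ : Sig n}
    (h : ∀ i ∈ Ψ, σ i = none) (ω : St n) : thresholdScore Ψ 1 σ ω = 1 / 2 := by
  have hcard : (Ψ.filter fun i => σ i = some (ω i)) = ∅ :=
    filter_eq_empty_iff.mpr fun i hi => by simp [h i hi]
  have hno : ¬ ∃ i ∈ Ψ, σ i ≠ none ∧ σ i ≠ some (ω i) :=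
    fun ⟨i, hi, hn, _⟩ => hn (h i hi)
  unfold thresholdScore
  rw [if_neg hno]
  simp [hcard]

lemma thresholdScore_one_of_consistent {n : ℕ} {Ψ : Finset (Fin n)} {σ : Sig n} {ω : St n}
    (hc : ∀ i, σ i = none ∨ σ i = some (ω i)) {i : Fin n} (hi : i ∈ Ψ) (hs : σ i ≠ none) :
    thresholdScore Ψ 1 σ ω = 1 := by
  have hno : ¬ ∃ i ∈ Ψ, σ i ≠ none ∧ σ i ≠ some (ω i) :=
    fun ⟨j, _, hn, hn'⟩ => (hc j).elim hn hn'
  unfold thresholdScore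
  rw [if_neg hno, if_pos]
  exact card_pos.mpr ⟨i, mem_filter.mpr ⟨hi, (hc i).resolve_left hs⟩⟩

lemma thresholdScore_one_le_ite {n : ℕ} {Ψ : Finset (Fin n)} {σ : Sig n} {i : Fin n} {b : Bool}
    (hi : i ∈ Ψ) (hs : σ i = some b) (ω : St n) :
    thresholdScore Ψ 1 σ ω ≤ if ω i = b then 1 else 0 := by
  split_ifs with h
  · exact thresholdScore_one_le_one Ψ σ ω
  · unfold thresholdScore
    rw [if_pos ⟨i, hi, by simp [hs], by simpa [hs] using Ne.symm h⟩]

lemma postExp_thresholdScore_one_of_forall_none {n : ℕ} {Ψ : Finset (Fin n)} {σ' : Sig n}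
    (h : ∀ i ∈ Ψ, σ' i = none) (σ : Sig n) : postExp σ (thresholdScore Ψ 1 σ') = 1 / 2 := by
  rw [funext (thresholdScore_one_of_forall_none h), postExp_const]

lemma postExp_thresholdScore_one_of_exists {n : ℕ} {Ψ : Finset (Fin n)} {σ : Sig n} {i : Fin n}
    (hi : i ∈ Ψ) (hs : σ i ≠ none) : postExp σ (thresholdScore Ψ 1 σ) = 1 := by
  rw [← sum_postProb σ, postExp]
  refine sum_congr rfl fun ω _ => ?_
  by_cases h : postProb σ ω = 0
  · rw [h, zero_mul]
  · rw [thresholdScore_one_of_consistent (eq_of_postProb_ne_zero h) hi hs, mul_one]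

lemma proper_thresholdScore_one {n : ℕ} (Ψ : Finset (Fin n)) :
    Proper (thresholdScore Ψ 1) := by
  intro σ σ'
  by_cases h : ∀ i ∈ Ψ, σ i = none
  · rw [postExp_thresholdScore_one_of_forall_none h]
    by_cases h' : ∀ i ∈ Ψ, σ' i = none
    · rw [postExp_thresholdScore_one_of_forall_none h']
    · push Not at h'
      obtain ⟨i, hi, hs⟩ := h'
      obtain ⟨b, hb⟩ := Option.ne_none_iff_exists'.mp hs
      exact (postExp_mono σ (thresholdScore_one_le_ite hi hb)).trans_eq
        (postExp_ite_eq_half σ i (h i hi) b)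
  · push Not at h
    obtain ⟨i, hi, hs⟩ := h
    rw [postExp_thresholdScore_one_of_exists hi hs]
    exact (postExp_mono σ (thresholdScore_one_le_one Ψ σ')).trans_eq (postExp_const σ 1)

lemma postExp_thresholdScore_one_self {n : ℕ} (Ψ : Finset (Fin n)) (σ : Sig n) :
    postExp σ (thresholdScore Ψ 1 σ) =
      1 - 1 / 2 * ∏ i, if i ∈ Ψ then (σ i).elim (1 : ℝ) (fun _ => 0) else 1 := by
  by_cases h : ∀ i ∈ Ψ, σ i = none
  · rw [postExp_thresholdScore_one_of_forall_none h, prod_eq_one]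
    · norm_num
    · intro i _
      split_ifs with hi
      · simp [h i hi]
      · rfl
  · push Not at h
    obtain ⟨i, hi, hs⟩ := h
    obtain ⟨b, hb⟩ := Option.ne_none_iff_exists'.mp hs
    rw [postExp_thresholdScore_one_of_exists hi hs,
      prod_eq_zero (mem_univ i) (by simp [hi, hb])]
    norm_num

lemma sum_sigProb {n : ℕ} (p : Fin n → ℝ) (Φ : Finset (Fin n)) : ∑ σ, sigProb p Φ σ = 1 := by
  unfold sigProb
  rw [← Fintype.prod_sum (fun i (o : Option Bool) =>
    if i ∈ Φ then o.elim (1 - p i) (fun _ => p i / 2) else o.elim 1 (fun _ => 0))]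
  refine prod_eq_one fun i _ => ?_
  split_ifs
  · simp [Fintype.sum_option, mul_div_cancel₀]
  · simp [Fintype.sum_option]

/-- The probability that effort on `Φ` reveals no state in `Ψ`. -/
lemma sum_sigProb_mul_prod {n : ℕ} (p : Fin n → ℝ) (Ψ Φ : Finset (Fin n)) :
    ∑ σ, sigProb p Φ σ * ∏ i, (if i ∈ Ψ then (σ i).elim (1 : ℝ) (fun _ => 0) else 1) =
      ∏ i ∈ Ψ ∩ Φ, (1 - p i) := by
  unfold sigProb
  simp_rw [← prod_mul_distrib]
  rw [← Fintype.prod_sum (fun i (o : Option Bool) =>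
    (if i ∈ Φ then o.elim (1 - p i) (fun _ => p i / 2) else o.elim 1 (fun _ => 0)) *
      (if i ∈ Ψ then o.elim (1 : ℝ) (fun _ => 0) else 1)), ← prod_subset (subset_univ (Ψ ∩ Φ))]
  · refine prod_congr rfl fun i hi => ?_
    simp [(mem_inter.mp hi).1, (mem_inter.mp hi).2, Fintype.sum_option]
  · intro i _ hi
    by_cases h1 : i ∈ Ψ <;> by_cases h2 : i ∈ Φ <;> simp_all [Fintype.sum_option, mul_div_cancel₀]

lemma expScore_thresholdScore_one {n : ℕ} (p : Fin n → ℝ) (Ψ Φ : Finset (Fin n)) :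
    expScore p Φ (thresholdScore Ψ 1) = 1 - 1 / 2 * ∏ i ∈ Ψ ∩ Φ, (1 - p i) := by
  unfold expScore
  simp_rw [postExp_thresholdScore_one_self, mul_sub, mul_one, mul_left_comm _ (1 / 2 : ℝ)]
  rw [sum_sub_distrib, ← mul_sum, sum_sigProb, sum_sigProb_mul_prod]

lemma one_sub_sum_le_prod_one_sub {ι : Type*} (s : Finset ι) (p : ι → ℝ)
    (hp : ∀ i ∈ s, 0 ≤ p i ∧ p i ≤ 1) : 1 - ∑ i ∈ s, p i ≤ ∏ i ∈ s, (1 - p i) := by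
  classical
  induction s using Finset.induction_on with
  | empty => simp
  | insert i s hi ih =>
    rw [sum_insert hi, prod_insert hi]
    have hps : ∀ j ∈ s, 0 ≤ p j ∧ p j ≤ 1 := fun j hj => hp j (mem_insert_of_mem hj)
    obtain ⟨h0, -⟩ := hp i (mem_insert_self i s)
    have hle : ∏ j ∈ s, (1 - p j) ≤ 1 :=
      prod_le_one (fun j hj => by linarith [hps j hj]) (fun j hj => by linarith [hps j hj])
    nlinarith [ih hps]

/-- Dropping tasks from the recommended set does not increase the agent's utility. -/
lemma utility_sdiff_le {n : ℕ} {p c : Fin n → ℝ} (hp : ∀ i, 0 ≤ p i ∧ p i ≤ 1)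
    {Ψ : Finset (Fin n)}
    (hinc : ∀ i' ∈ Ψ, (1 - ∑ i ∈ Ψ.erase i', p i) * (p i' / 2) ≥ c i')
    (B : Finset (Fin n)) (hB : B ⊆ Ψ) :
    (1 - 1 / 2 * ∏ i ∈ Ψ \ B, (1 - p i)) - ∑ i ∈ Ψ \ B, c i ≤
      (1 - 1 / 2 * ∏ i ∈ Ψ, (1 - p i)) - ∑ i ∈ Ψ, c i := by
  induction B using Finset.induction_on with
  | empty => simp
  | insert j B hj ih =>
    refine le_trans ?_ (ih ((subset_insert j B).trans hB))
    have hjΨ : j ∈ Ψ := hB (mem_insert_self j B)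
    have hmem : j ∈ Ψ \ B := mem_sdiff.mpr ⟨hjΨ, hj⟩
    rw [sdiff_insert, ← mul_prod_erase _ (fun i => 1 - p i) hmem, ← add_sum_erase _ c hmem]
    have hsum : ∑ i ∈ (Ψ \ B).erase j, p i ≤ ∑ i ∈ Ψ.erase j, p i :=
      sum_le_sum_of_subset_of_nonneg (erase_subset_erase j sdiff_subset)
        fun i _ _ => (hp i).1
    have hprod := one_sub_sum_le_prod_one_sub ((Ψ \ B).erase j) p fun i _ => hp i
    have hgain := mul_le_mul_of_nonneg_right
      (show 1 - ∑ i ∈ Ψ.erase j, p i ≤ ∏ i ∈ (Ψ \ B).erase j, (1 - p i) by linarith)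
      (div_nonneg (hp j).1 zero_le_two)
    linarith [hinc j hjΨ]

end KS

/-- Incentive compatibility of the threshold-1 scoring rule: if for every
`i' ∈ Ψ` we have `(1 - ∑_{i ∈ Ψ∖{i'}} p i) · p i' / 2 ≥ c i'`, then the
threshold scoring rule with set `Ψ` and threshold 1 is proper and the mechanism
`(thresholdScore Ψ 1, Ψ)` is incentive compatible. -/
theorem stmt10 {n : ℕ} (p c : Fin n → ℝ)
    (hp : ∀ i, 0 < p i ∧ p i ≤ 1) (hc : ∀ i, 0 < c i)
    (Ψ : Finset (Fin n))
    (hinc : ∀ i' ∈ Ψ, (1 - ∑ i ∈ Ψ.erase i', p i) * (p i' / 2) ≥ c i') :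
    KS.Proper (KS.thresholdScore Ψ 1) ∧ KS.IC p c (KS.thresholdScore Ψ 1) Ψ := by
  refine ⟨KS.proper_thresholdScore_one Ψ, KS.proper_thresholdScore_one Ψ, fun Φ => ?_⟩
  rw [KS.expScore_thresholdScore_one, KS.expScore_thresholdScore_one, inter_self]
  have hutil := KS.utility_sdiff_le (fun i => ⟨(hp i).1.le, (hp i).2⟩) hinc (Ψ \ Φ) sdiff_subset
  rw [sdiff_sdiff_right_self, inf_eq_inter] at hutil
  have hcost : ∑ i ∈ Ψ ∩ Φ, c i ≤ ∑ i ∈ Φ, c i :=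
    sum_le_sum_of_subset_of_nonneg inter_subset_right fun i _ _ => (hc i).le
  linarith
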